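/- Let (Ω,𝒜,T,μ,ℱ,‖·‖,χ) fulfill Property 𝔇 with μ(χ>x)=L(x)/x^α for all x>0, L slowly varying, 0<α<1; let (b_n) be natural numbers tending to infinity with b_n=o(n); put ζ_n := b_n^{2/3}, g_n := F^←(1−(b_n−ζ_n)/n); assume ψ(r)<1 where r := min{n∈ℕ : ψ(n)<1}. Define Φ'_{k,n} := { #{ j≤n : χ∘T^{j-1} > 2^{k-1}·g_n } > b_n − 2r + 1 }. Then Σ_{k=2}^{∞} (∫ T_n^{2^k·g_n}χ dμ) · μ(Φ'_{k,n}) = o( ∫ T_n^{g_n}χ dμ ) as n→∞. -/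

import Mathlib

open MeasureTheory Filter Topology ENNReal

noncomputable section

/-- Birkhoff sum `S_n χ = ∑_{k=1}^n χ ∘ T^{k-1}`. -/
def birkhoffSumN {Ω : Type*} (T : Ω → Ω) (χ : Ω → ℝ) (n : ℕ) (ω : Ω) : ℝ :=
  ∑ k ∈ Finset.range n, χ (T^[k] ω)

/-- Trimmed sum `S_n^b χ`: the sum of the `n - b` smallest values among
`χ(ω), χ(Tω), …, χ(T^{n-1}ω)`. -/
def trimmedSumN {Ω : Type*} (T : Ω → Ω) (χ : Ω → ℝ) (n b : ℕ) (ω : Ω) : ℝ :=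
  (((((List.range n).map fun k => χ (T^[k] ω))).mergeSort (fun a b => a ≤ b)).take (n - b)).sum

/-- Truncated sum `T_n^f χ = ∑_{k=1}^n (χ·1_{χ ≤ f}) ∘ T^{k-1}`. -/
def truncSumN {Ω : Type*} (T : Ω → Ω) (χ : Ω → ℝ) (n : ℕ) (f : ℝ) (ω : Ω) : ℝ :=
  ∑ k ∈ Finset.range n, if χ (T^[k] ω) ≤ f then χ (T^[k] ω) else 0

/-- A function `L` is slowly varying if `L(cx)/L(x) → 1` as `x → ∞`, for every `c > 0`. -/
def SlowlyVarying (L : ℝ → ℝ) : Prop :=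
  ∀ c : ℝ, 0 < c → Tendsto (fun x => L (c * x) / L x) atTop (𝓝 1)

/-- `ls` is a de Bruijn conjugate of the slowly varying function `Lt`. -/
def IsDeBruijnConjugate (Lt ls : ℝ → ℝ) : Prop :=
  SlowlyVarying ls ∧
  Tendsto (fun x => Lt x * ls (x * Lt x)) atTop (𝓝 1) ∧
  Tendsto (fun x => ls x * Lt (x * ls x)) atTop (𝓝 1)

/-- The measure of dependence `ψ(ℬ,𝒞)` between two sub-σ-fields. -/
def psiDep {Ω : Type*} [MeasurableSpace Ω] (μ : Measure Ω)
    (B C : MeasurableSpace Ω) : ℝ≥0∞ :=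
  ⨆ (b : Set Ω) (c : Set Ω) (_ : MeasurableSet[B] b) (_ : MeasurableSet[C] c)
    (_ : 0 < μ b) (_ : 0 < μ c),
    ENNReal.ofReal |(μ (b ∩ c)).toReal / ((μ b).toReal * (μ c).toReal) - 1|

/-- The σ-field generated by `X_k = χ ∘ T^{k-1}` for `J ≤ k ≤ L`. -/
def sigmaIcc {Ω : Type*} [MeasurableSpace Ω] (T : Ω → Ω) (χ : Ω → ℝ) (J L : ℕ) :
    MeasurableSpace Ω :=
  ⨆ k ∈ Set.Icc J L, MeasurableSpace.comap (fun ω => χ (T^[k - 1] ω)) inferInstance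

/-- The σ-field generated by `X_k = χ ∘ T^{k-1}` for `k ≥ J`. -/
def sigmaIci {Ω : Type*} [MeasurableSpace Ω] (T : Ω → Ω) (χ : Ω → ℝ) (J : ℕ) :
    MeasurableSpace Ω :=
  ⨆ k ∈ Set.Ici J, MeasurableSpace.comap (fun ω => χ (T^[k - 1] ω)) inferInstance

/-- The `n`-th ψ-mixing coefficient of the sequence `(χ ∘ T^{k-1})_{k ≥ 1}`. -/
def psiCoeff {Ω : Type*} [MeasurableSpace Ω] (μ : Measure Ω) (T : Ω → Ω) (χ : Ω → ℝ)
    (n : ℕ) : ℝ≥0∞ :=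
  ⨆ (k : ℕ) (_ : 1 ≤ k), psiDep μ (sigmaIcc T χ 1 k) (sigmaIci T χ (k + n))

/-- A bounded operator `U` has a spectral gap: `U = λ·P + N` with `P` a one-dimensional
projection, `ρ(N) < |λ|`, and `PN = NP = 0`. -/
def HasSpectralGap {F : Type*} [NormedAddCommGroup F] [NormedSpace ℝ F] [CompleteSpace F]
    (U : F →L[ℝ] F) : Prop :=
  ∃ (lam : ℝ) (P N : F →L[ℝ] F),
    U = lam • P + N ∧ P.comp P = P ∧
    Module.finrank ℝ (LinearMap.range (P : F →ₗ[ℝ] F)) = 1 ∧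
    spectralRadius ℝ N < ENNReal.ofReal |lam| ∧
    P.comp N = 0 ∧ N.comp P = 0

/-- Property ℭ: `μ` is a `T`-invariant mixing probability measure, `ℱ` (realized as a Banach
algebra `F` of measurable functions via the injective algebra homomorphism `ι`) contains the
constants, dominates the sup norm, and the transfer operator restricts to a bounded operator
on `F` with a spectral gap. -/
structure PropertyC {Ω : Type*} [MeasurableSpace Ω] (T : Ω → Ω) (μ : Measure Ω)
    {F : Type*} [NormedRing F] [NormedAlgebra ℝ F] [CompleteSpace F]
    (ι : F →ₐ[ℝ] Ω → ℝ) : Prop where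
  prob : IsProbabilityMeasure μ
  invariant : MeasurePreserving T μ μ
  mixing : ∀ A B : Set Ω, MeasurableSet A → MeasurableSet B →
    Tendsto (fun n => μ (A ∩ T^[n] ⁻¹' B)) atTop (𝓝 (μ A * μ B))
  inj : Function.Injective ι
  measurable_mem : ∀ f : F, Measurable (ι f)
  norm_ge_sup : ∀ (f : F) (ω : Ω), |ι f ω| ≤ ‖f‖
  transfer : ∃ That : F →L[ℝ] F,
    (∀ (f : F) (g : Ω → ℝ), Measurable g → (∃ C, ∀ ω, |g ω| ≤ C) →
      ∫ ω, ι (That f) ω * g ω ∂μ = ∫ ω, ι f ω * g (T ω) ∂μ) ∧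
    HasSpectralGap That

/-- Property 𝔇: Property ℭ together with the norm control on truncations of the
nonnegative observable `χ`. -/
structure PropertyD {Ω : Type*} [MeasurableSpace Ω] (T : Ω → Ω) (μ : Measure Ω)
    {F : Type*} [NormedRing F] [NormedAlgebra ℝ F] [CompleteSpace F]
    (ι : F →ₐ[ℝ] Ω → ℝ) (χ : Ω → ℝ) extends PropertyC T μ ι : Prop where
  chi_nonneg : ∀ ω, 0 ≤ χ ω
  chi_meas : Measurable χ
  norm_bound : ∃ K₁ > (0 : ℝ), ∀ ℓ : ℝ, 0 ≤ ℓ →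
    (∃ f : F, ι f = (fun ω => if χ ω ≤ ℓ then χ ω else 0) ∧ ‖f‖ ≤ K₁ * ℓ) ∧
    (∃ g : F, ι g = (fun ω => if ℓ < χ ω then (1 : ℝ) else 0) ∧ ‖g‖ ≤ K₁)

/-- The distribution function `F(x) = μ(χ ≤ x)`. -/
def distF {Ω : Type*} [MeasurableSpace Ω] (μ : Measure Ω) (χ : Ω → ℝ) (x : ℝ) : ℝ :=
  (μ {ω | χ ω ≤ x}).toReal

/-- Generalized inverse `F^←(y) = inf {x | F(x) ≥ y}`. -/
def genInv (F : ℝ → ℝ) (y : ℝ) : ℝ := sInf {x : ℝ | y ≤ F x}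

/-- `g_n = F^←(1 - (b_n - ζ_n)/n)` where `ζ_n = b_n^{2/3}`. -/
def gSeq {Ω : Type*} [MeasurableSpace Ω] (μ : Measure Ω) (χ : Ω → ℝ) (b : ℕ → ℕ)
    (n : ℕ) : ℝ :=
  genInv (distF μ χ) (1 - ((b n : ℝ) - (b n : ℝ) ^ ((2 : ℝ) / 3)) / n)

/-- The norming sequence `d_n = (α/(1-α))·n^{1/α}·b_n^{1-1/α}·ℓ^#((n/b_n)^{1/α})`. -/
def dSeq (α : ℝ) (ls : ℝ → ℝ) (b : ℕ → ℕ) (n : ℕ) : ℝ :=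
  α / (1 - α) * (n : ℝ) ^ (1 / α) * (b n : ℝ) ^ (1 - 1 / α) *
    ls (((n : ℝ) / (b n : ℝ)) ^ (1 / α))

end

/-- number of indices `j ∈ s` with `Y_j > t`. -/
noncomputable def cntY {Ω : Type*} (Y : ℕ → Ω → ℝ) (t : ℝ) (s : Finset ℕ) (ω : Ω) : ℕ :=
  (s.filter fun j => t < Y j ω).card

lemma cntY_measurable {Ω : Type*} [MeasurableSpace Ω] (Y : ℕ → Ω → ℝ) (t : ℝ) (s : Finset ℕ)
    (h : ∀ j ∈ s, Measurable (Y j)) : Measurable (cntY Y t s) := by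
  have : cntY Y t s = fun ω => ∑ j ∈ s, if t < Y j ω then 1 else 0 := by
    funext ω; simp only [cntY, Finset.card_filter]
  rw [this]
  refine Finset.measurable_sum _ fun j hj => ?_
  exact Measurable.ite (measurableSet_lt measurable_const (h j hj)) measurable_const
    measurable_const

lemma cntY_le {Ω : Type*} (Y : ℕ → Ω → ℝ) (t : ℝ) (s : Finset ℕ) (ω : Ω) :
    cntY Y t s ω ≤ s.card := Finset.card_filter_le _ _

lemma cntY_union {Ω : Type*} (Y : ℕ → Ω → ℝ) (t : ℝ) (s s' : Finset ℕ) (h : Disjoint s s')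
    (ω : Ω) : cntY Y t (s ∪ s') ω = cntY Y t s ω + cntY Y t s' ω := by
  simp only [cntY, Finset.filter_union]
  exact Finset.card_union_of_disjoint (Finset.disjoint_filter_filter h)

lemma cntY_mono {Ω : Type*} (Y : ℕ → Ω → ℝ) (t : ℝ) (s s' : Finset ℕ) (h : s ⊆ s')
    (ω : Ω) : cntY Y t s ω ≤ cntY Y t s' ω :=
  Finset.card_le_card (Finset.filter_subset_filter _ h)

lemma integral_nat_fun {Ω : Type*} [MeasurableSpace Ω] (μ : Measure Ω) [IsProbabilityMeasure μ]
    (f : Ω → ℕ) (hf : Measurable f) (M : ℕ) (hM : ∀ ω, f ω ≤ M) (φ : ℕ → ℝ) :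
    ∫ ω, φ (f ω) ∂μ = ∑ a ∈ Finset.range (M + 1), φ a * μ.real (f ⁻¹' {a}) := by
  have h : ∀ ω, φ (f ω) = ∑ a ∈ Finset.range (M + 1),
      (f ⁻¹' {a}).indicator (fun _ => φ a) ω := by
    intro ω
    rw [Finset.sum_eq_single (f ω)]
    · simp
    · intro b _ hb
      apply Set.indicator_of_notMem
      simpa using hb.symm
    · intro h; exact absurd (Finset.mem_range.2 (Nat.lt_succ_of_le (hM ω))) h
  have hm : ∀ a, MeasurableSet (f ⁻¹' {a}) := fun a => hf (measurableSet_singleton a)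
  simp_rw [h]
  rw [integral_finsetSum]
  · refine Finset.sum_congr rfl fun a _ => ?_
    rw [integral_indicator_const _ (hm a), smul_eq_mul, mul_comm]
  · intro a _
    exact (integrable_const _).indicator (hm a)

lemma integrable_nat_fun {Ω : Type*} [MeasurableSpace Ω] (μ : Measure Ω) [IsProbabilityMeasure μ]
    (f : Ω → ℕ) (hf : Measurable f) (M : ℕ) (hM : ∀ ω, f ω ≤ M) (φ : ℕ → ℝ) :
    Integrable (fun ω => φ (f ω)) μ := by
  refine Integrable.of_bound ((measurable_of_countable φ).comp hf).aestronglyMeasurable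
    (∑ a ∈ Finset.range (M + 1), |φ a|) (Eventually.of_forall fun ω => ?_)
  rw [Real.norm_eq_abs]
  exact Finset.single_le_sum (f := fun a => |φ a|) (fun _ _ => abs_nonneg _)
    (Finset.mem_range.2 (Nat.lt_succ_of_le (hM ω)))

lemma integral_nat_fun2 {Ω : Type*} [MeasurableSpace Ω] (μ : Measure Ω) [IsProbabilityMeasure μ]
    (f g : Ω → ℕ) (hf : Measurable f) (hg : Measurable g) (M M' : ℕ) (hM : ∀ ω, f ω ≤ M)
    (hM' : ∀ ω, g ω ≤ M') (φ φ' : ℕ → ℝ) :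
    ∫ ω, φ (f ω) * φ' (g ω) ∂μ = ∑ a ∈ Finset.range (M + 1), ∑ c ∈ Finset.range (M' + 1),
      φ a * φ' c * μ.real (f ⁻¹' {a} ∩ g ⁻¹' {c}) := by
  have h : ∀ ω, φ (f ω) * φ' (g ω) = ∑ a ∈ Finset.range (M + 1), ∑ c ∈ Finset.range (M' + 1),
      (f ⁻¹' {a} ∩ g ⁻¹' {c}).indicator (fun _ => φ a * φ' c) ω := by
    intro ω
    rw [Finset.sum_eq_single (f ω), Finset.sum_eq_single (g ω)]
    · simp
    · intro b _ hb
      apply Set.indicator_of_notMem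
      simpa using hb.symm
    · intro h; exact absurd (Finset.mem_range.2 (Nat.lt_succ_of_le (hM' ω))) h
    · intro b _ hb
      refine Finset.sum_eq_zero fun c _ => ?_
      apply Set.indicator_of_notMem
      simp only [Set.mem_inter_iff, Set.mem_preimage, Set.mem_singleton_iff, not_and]
      intro h; exact absurd h.symm hb
    · intro h; exact absurd (Finset.mem_range.2 (Nat.lt_succ_of_le (hM ω))) h
  have hm : ∀ a c, MeasurableSet (f ⁻¹' {a} ∩ g ⁻¹' {c}) := fun a c =>
    (hf (measurableSet_singleton a)).inter (hg (measurableSet_singleton c))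
  simp_rw [h]
  rw [integral_finsetSum]
  · refine Finset.sum_congr rfl fun a _ => ?_
    rw [integral_finsetSum]
    · refine Finset.sum_congr rfl fun c _ => ?_
      rw [integral_indicator_const _ (hm a c), smul_eq_mul, mul_comm]
    · intro c _
      exact (integrable_const _).indicator (hm a c)
  · intro a _
    exact integrable_finsetSum _ fun c _ => (integrable_const _).indicator (hm a c)

lemma cov_bound {Ω : Type*} [MeasurableSpace Ω] (μ : Measure Ω) [IsProbabilityMeasure μ]
    (f g : Ω → ℕ) (hf : Measurable f) (hg : Measurable g) (M M' : ℕ) (hM : ∀ ω, f ω ≤ M)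
    (hM' : ∀ ω, g ω ≤ M') (φ φ' : ℕ → ℝ) (ψ : ℝ)
    (h : ∀ a c, |μ.real (f ⁻¹' {a} ∩ g ⁻¹' {c}) - μ.real (f ⁻¹' {a}) * μ.real (g ⁻¹' {c})| ≤
      ψ * (μ.real (f ⁻¹' {a}) * μ.real (g ⁻¹' {c}))) :
    |∫ ω, φ (f ω) * φ' (g ω) ∂μ - (∫ ω, φ (f ω) ∂μ) * ∫ ω, φ' (g ω) ∂μ| ≤
      ψ * ((∫ ω, |φ (f ω)| ∂μ) * ∫ ω, |φ' (g ω)| ∂μ) := by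
  rw [integral_nat_fun2 μ f g hf hg M M' hM hM' φ φ', integral_nat_fun μ f hf M hM φ,
    integral_nat_fun μ g hg M' hM' φ', integral_nat_fun μ f hf M hM (fun a => |φ a|),
    integral_nat_fun μ g hg M' hM' (fun a => |φ' a|), Finset.sum_mul_sum, Finset.sum_mul_sum,
    ← Finset.sum_sub_distrib, Finset.mul_sum]
  refine (Finset.abs_sum_le_sum_abs _ _).trans (Finset.sum_le_sum fun a _ => ?_)
  rw [← Finset.sum_sub_distrib, Finset.mul_sum]
  refine (Finset.abs_sum_le_sum_abs _ _).trans (Finset.sum_le_sum fun c _ => ?_)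
  have e1 : φ a * φ' c * μ.real (f ⁻¹' {a} ∩ g ⁻¹' {c}) -
      φ a * μ.real (f ⁻¹' {a}) * (φ' c * μ.real (g ⁻¹' {c})) = (φ a * φ' c) *
      (μ.real (f ⁻¹' {a} ∩ g ⁻¹' {c}) - μ.real (f ⁻¹' {a}) * μ.real (g ⁻¹' {c})) := by ring
  rw [e1, abs_mul, abs_mul]
  calc _ ≤ |φ a| * |φ' c| * (ψ * (μ.real (f ⁻¹' {a}) * μ.real (g ⁻¹' {c}))) :=
        mul_le_mul_of_nonneg_left (h a c) (by positivity)
    _ = _ := by ring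

/-- The `ψ`-mixing bound with gap `r`. -/
def MixBound {Ω : Type*} [MeasurableSpace Ω] (μ : Measure Ω) (T : Ω → Ω) (χ : Ω → ℝ) (r : ℕ)
    (ψ : ℝ) : Prop :=
  ∀ k, 1 ≤ k → ∀ A C : Set Ω, MeasurableSet[sigmaIcc T χ 1 k] A →
    MeasurableSet[sigmaIci T χ (k + r)] C →
    |μ.real (A ∩ C) - μ.real A * μ.real C| ≤ ψ * (μ.real A * μ.real C)

lemma mixBound_of_psi {Ω : Type*} [MeasurableSpace Ω] (μ : Measure Ω) [IsProbabilityMeasure μ]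
    (T : Ω → Ω) (χ : Ω → ℝ) (r : ℕ) (h : psiCoeff μ T χ r < 1) :
    MixBound μ T χ r (psiCoeff μ T χ r).toReal := by
  intro k hk A C hA hC
  by_cases hA0 : μ A = 0
  · have h1 : μ.real A = 0 := by simp [Measure.real, hA0]
    have h2 : μ.real (A ∩ C) = 0 := by
      simp [Measure.real, measure_mono_null Set.inter_subset_left hA0]
    simp [h1, h2]
  by_cases hC0 : μ C = 0
  · have h1 : μ.real C = 0 := by simp [Measure.real, hC0]
    have h2 : μ.real (A ∩ C) = 0 := by
      simp [Measure.real, measure_mono_null Set.inter_subset_right hC0]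
    simp [h1, h2]
  have hle : ENNReal.ofReal |(μ (A ∩ C)).toReal / ((μ A).toReal * (μ C).toReal) - 1| ≤
      psiCoeff μ T χ r := by
    unfold psiCoeff psiDep
    refine le_iSup₂_of_le k hk ?_
    refine le_iSup₂_of_le A C ?_
    refine le_iSup₂_of_le hA hC ?_
    exact le_iSup₂_of_le (pos_iff_ne_zero.2 hA0) (pos_iff_ne_zero.2 hC0) le_rfl
  have h3 := (ENNReal.ofReal_le_iff_le_toReal h.ne_top).1 hle
  have hAp : 0 < μ.real A := ENNReal.toReal_pos hA0 (measure_ne_top _ _)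
  have hCp : 0 < μ.real C := ENNReal.toReal_pos hC0 (measure_ne_top _ _)
  change |μ.real (A ∩ C) / (μ.real A * μ.real C) - 1| ≤ _ at h3
  have hp : 0 < μ.real A * μ.real C := mul_pos hAp hCp
  have : μ.real (A ∩ C) - μ.real A * μ.real C =
      (μ.real (A ∩ C) / (μ.real A * μ.real C) - 1) * (μ.real A * μ.real C) := by
    field_simp
  rw [this, abs_mul, abs_of_pos hp]
  exact mul_le_mul_of_nonneg_right h3 hp.le

lemma mix_cov {Ω : Type*} [MeasurableSpace Ω] (μ : Measure Ω) [IsProbabilityMeasure μ]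
    (T : Ω → Ω) (hT : Measurable T) (χ : Ω → ℝ) (hχ : Measurable χ) (r : ℕ) (ψ : ℝ)
    (h : MixBound μ T χ r ψ) (t : ℝ) (k : ℕ) (hk : 1 ≤ k) (s s' : Finset ℕ)
    (hs : ∀ j ∈ s, j < k) (hs' : ∀ j ∈ s', k + r ≤ j + 1) (φ φ' : ℕ → ℝ) :
    |∫ ω, φ (cntY (fun j ω => χ (T^[j] ω)) t s ω) * φ' (cntY (fun j ω => χ (T^[j] ω)) t s' ω) ∂μ -
      (∫ ω, φ (cntY (fun j ω => χ (T^[j] ω)) t s ω) ∂μ) *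
        ∫ ω, φ' (cntY (fun j ω => χ (T^[j] ω)) t s' ω) ∂μ| ≤
      ψ * ((∫ ω, |φ (cntY (fun j ω => χ (T^[j] ω)) t s ω)| ∂μ) *
        ∫ ω, |φ' (cntY (fun j ω => χ (T^[j] ω)) t s' ω)| ∂μ) := by
  have hY : ∀ j, Measurable fun ω => χ (T^[j] ω) := fun j => hχ.comp (hT.iterate j)
  refine cov_bound μ _ _ (cntY_measurable _ _ _ fun j _ => hY j)
    (cntY_measurable _ _ _ fun j _ => hY j) s.card s'.card (cntY_le _ _ _) (cntY_le _ _ _)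
    φ φ' ψ fun a c => ?_
  refine h k hk _ _ ?_ ?_
  · refine @cntY_measurable Ω (sigmaIcc T χ 1 k) _ t s ?_ _ (measurableSet_singleton a)
    intro j hj
    refine Measurable.of_comap_le ?_
    have := le_iSup₂ (f := fun l (_ : l ∈ Set.Icc 1 k) =>
      MeasurableSpace.comap (fun ω => χ (T^[l - 1] ω)) inferInstance) (j + 1)
      (⟨by omega, hs j hj⟩ : (j + 1) ∈ Set.Icc 1 k)
    exact this
  · refine @cntY_measurable Ω (sigmaIci T χ (k + r)) _ t s' ?_ _ (measurableSet_singleton c)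
    intro j hj
    refine Measurable.of_comap_le ?_
    have := le_iSup₂ (f := fun l (_ : l ∈ Set.Ici (k + r)) =>
      MeasurableSpace.comap (fun ω => χ (T^[l - 1] ω)) inferInstance) (j + 1)
      (hs' j hj : (j + 1) ∈ Set.Ici (k + r))
    exact this

noncomputable abbrev cT {Ω : Type*} (T : Ω → Ω) (χ : Ω → ℝ) (t : ℝ) (s : Finset ℕ) (ω : Ω) : ℕ :=
  cntY (fun j ω => χ (T^[j] ω)) t s ω

lemma cT_measurable {Ω : Type*} [MeasurableSpace Ω] (T : Ω → Ω) (hT : Measurable T) (χ : Ω → ℝ)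
    (hχ : Measurable χ) (t : ℝ) (s : Finset ℕ) : Measurable (cT T χ t s) :=
  cntY_measurable _ _ _ fun j _ => hχ.comp (hT.iterate j)

lemma cT_integrable {Ω : Type*} [MeasurableSpace Ω] (μ : Measure Ω) [IsProbabilityMeasure μ]
    (T : Ω → Ω) (hT : Measurable T) (χ : Ω → ℝ)
    (hχ : Measurable χ) (t : ℝ) (s : Finset ℕ) (φ : ℕ → ℝ) :
    Integrable (fun ω => φ (cT T χ t s ω)) μ :=
  integrable_nat_fun μ _ (cT_measurable T hT χ hχ t s) s.card (cntY_le _ _ _) φ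

lemma cT_integrable2 {Ω : Type*} [MeasurableSpace Ω] (μ : Measure Ω) [IsProbabilityMeasure μ]
    (T : Ω → Ω) (hT : Measurable T) (χ : Ω → ℝ)
    (hχ : Measurable χ) (t : ℝ) (s s' : Finset ℕ) (φ φ' : ℕ → ℝ) :
    Integrable (fun ω => φ (cT T χ t s ω) * φ' (cT T χ t s' ω)) μ := by
  refine (cT_integrable μ T hT χ hχ t s' φ').bdd_mul (c := ∑ a ∈ Finset.range (s.card + 1), |φ a|)
    (cT_integrable μ T hT χ hχ t s φ).aestronglyMeasurable (Eventually.of_forall fun ω => ?_)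
  rw [Real.norm_eq_abs]
  exact Finset.single_le_sum (f := fun a => |φ a|) (fun _ _ => abs_nonneg _)
    (Finset.mem_range.2 (Nat.lt_succ_of_le (cntY_le _ _ _ _)))

lemma cT_shift {Ω : Type*} (T : Ω → Ω) (χ : Ω → ℝ) (t : ℝ) (s : Finset ℕ) (a : ℕ) (ω : Ω) :
    cT T χ t (s.image (· + a)) ω = cT T χ t s (T^[a] ω) := by
  simp only [cT, cntY, Finset.filter_image]
  rw [Finset.card_image_of_injective _ (add_left_injective a)]
  simp only [Function.iterate_add_apply]

lemma cT_integral_shift {Ω : Type*} [MeasurableSpace Ω] (μ : Measure Ω) [IsProbabilityMeasure μ]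
    (T : Ω → Ω) (hT : MeasurePreserving T μ μ) (χ : Ω → ℝ)
    (hχ : Measurable χ) (t : ℝ) (s : Finset ℕ) (a : ℕ) (φ : ℕ → ℝ) :
    ∫ ω, φ (cT T χ t (s.image (· + a)) ω) ∂μ = ∫ ω, φ (cT T χ t s ω) ∂μ := by
  simp_rw [cT_shift]
  have h := integral_map (μ := μ) (hT.iterate a).measurable.aemeasurable
    (f := fun ω => φ (cT T χ t s ω)) (by
      rw [(hT.iterate a).map_eq]
      exact (cT_integrable μ T hT.measurable χ hχ t s φ).aestronglyMeasurable)
  rw [(hT.iterate a).map_eq] at h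
  exact h.symm

lemma cT_single {Ω : Type*} [MeasurableSpace Ω] (μ : Measure Ω) [IsProbabilityMeasure μ]
    (T : Ω → Ω) (hT : MeasurePreserving T μ μ) (χ : Ω → ℝ)
    (hχ : Measurable χ) (t : ℝ) (j : ℕ) :
    ∫ ω, (cT T χ t {j} ω : ℝ) ∂μ = μ.real {ω | t < χ ω} := by
  have h := cT_integral_shift μ T hT χ hχ t {0} j (fun x => (x : ℝ))
  simp only [Finset.image_singleton, zero_add] at h
  rw [h, ← integral_indicator_one (measurableSet_lt measurable_const hχ)]
  refine integral_congr_ae (Eventually.of_forall fun ω => ?_)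
  by_cases hh : t < χ ω <;> simp [cntY, Finset.filter_singleton, hh]

lemma cT_eq_sum {Ω : Type*} (T : Ω → Ω) (χ : Ω → ℝ) (t : ℝ) (s : Finset ℕ) (ω : Ω) :
    (cT T χ t s ω : ℝ) = ∑ j ∈ s, (cT T χ t {j} ω : ℝ) := by
  simp only [cntY, Finset.card_filter, Finset.sum_singleton, Nat.cast_sum]

lemma cT_mean {Ω : Type*} [MeasurableSpace Ω] (μ : Measure Ω) [IsProbabilityMeasure μ]
    (T : Ω → Ω) (hT : MeasurePreserving T μ μ) (χ : Ω → ℝ)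
    (hχ : Measurable χ) (t : ℝ) (s : Finset ℕ) :
    ∫ ω, (cT T χ t s ω : ℝ) ∂μ = s.card * μ.real {ω | t < χ ω} := by
  simp_rw [cT_eq_sum T χ t s]
  rw [integral_finsetSum]
  · simp [cT_single μ T hT χ hχ]
  · intro j _; exact cT_integrable μ T hT.measurable χ hχ t {j} (fun x => (x : ℝ))

/-- joint bound for pairs at distance at least `r` -/
lemma cT_pair {Ω : Type*} [MeasurableSpace Ω] (μ : Measure Ω) [IsProbabilityMeasure μ]
    (T : Ω → Ω) (hT : MeasurePreserving T μ μ) (χ : Ω → ℝ)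
    (hχ : Measurable χ) (r : ℕ) (ψ : ℝ) (hψ1 : ψ < 1)
    (h : MixBound μ T χ r ψ) (t : ℝ) (i j : ℕ) (hij : i + r ≤ j) :
    ∫ ω, (cT T χ t {i} ω : ℝ) * (cT T χ t {j} ω : ℝ) ∂μ ≤ 2 * μ.real {ω | t < χ ω} ^ 2 := by
  have h1 := mix_cov μ T hT.measurable χ hχ r ψ h t (i + 1) (by omega) {i} {j}
    (by simp) (by simp; omega) (fun x => (x : ℝ)) (fun x => (x : ℝ))
  simp only [Nat.abs_cast] at h1
  have e1 := cT_single μ T hT χ hχ t i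
  have e2 := cT_single μ T hT χ hχ t j
  simp only [cT] at e1 e2 ⊢
  rw [e1, e2] at h1
  have h2 := (abs_le.1 h1).2
  have : 0 ≤ μ.real {ω | t < χ ω} := measureReal_nonneg
  nlinarith [mul_nonneg this this]

lemma cT_second {Ω : Type*} [MeasurableSpace Ω] (μ : Measure Ω) [IsProbabilityMeasure μ]
    (T : Ω → Ω) (hT : MeasurePreserving T μ μ) (χ : Ω → ℝ)
    (hχ : Measurable χ) (r : ℕ) (ψ : ℝ) (hψ1 : ψ < 1)
    (h : MixBound μ T χ r ψ) (t : ℝ) (m : ℕ) :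
    ∫ ω, (cT T χ t (Finset.range m) ω : ℝ) ^ 2 ∂μ ≤
      2 * (m * μ.real {ω | t < χ ω}) ^ 2 + 2 * r * (m * μ.real {ω | t < χ ω}) := by
  set p := μ.real {ω | t < χ ω} with hp
  have hp0 : 0 ≤ p := measureReal_nonneg
  simp_rw [cT_eq_sum T χ t (Finset.range m), sq, Finset.sum_mul_sum]
  have hint : ∀ i j, Integrable (fun ω => (cT T χ t {i} ω : ℝ) * (cT T χ t {j} ω : ℝ)) μ :=
    fun i j => cT_integrable2 μ T hT.measurable χ hχ t {i} {j} (fun x => (x : ℝ))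
      (fun x => (x : ℝ))
  rw [integral_finsetSum _ fun i _ => integrable_finsetSum _ fun j _ => hint i j]
  simp_rw [integral_finsetSum (Finset.range m) fun j _ => hint _ j]
  have hterm : ∀ i j, ∫ ω, (cT T χ t {i} ω : ℝ) * (cT T χ t {j} ω : ℝ) ∂μ ≤
      2 * p ^ 2 + if j ∈ Finset.Ico (i + 1 - r) (i + r) then p else 0 := by
    intro i j
    split_ifs with hij
    · have : ∫ ω, (cT T χ t {i} ω : ℝ) * (cT T χ t {j} ω : ℝ) ∂μ ≤ p := by
        rw [hp, ← cT_single μ T hT χ hχ t i]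
        refine integral_mono (hint i j)
          (cT_integrable μ T hT.measurable χ hχ t {i} (fun x => (x : ℝ))) fun ω => ?_
        have h1 : (cT T χ t {j} ω : ℝ) ≤ 1 := by
          have := cntY_le (fun j ω => χ (T^[j] ω)) t {j} ω
          exact_mod_cast this
        exact mul_le_of_le_one_right (Nat.cast_nonneg _) h1
      nlinarith [sq_nonneg p]
    · rw [add_zero]
      rw [Finset.mem_Ico] at hij
      rcases le_or_gt (i + r) j with h1 | h1
      · exact cT_pair μ T hT χ hχ r ψ hψ1 h t i j h1
      · have := cT_pair μ T hT χ hχ r ψ hψ1 h t j i (by omega)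
        simp_rw [mul_comm (cT T χ t {i} _ : ℝ)]
        exact this
  calc _ ≤ ∑ i ∈ Finset.range m, ∑ j ∈ Finset.range m,
        (2 * p ^ 2 + if j ∈ Finset.Ico (i + 1 - r) (i + r) then p else 0) :=
        Finset.sum_le_sum fun i _ => Finset.sum_le_sum fun j _ => hterm i j
    _ ≤ ∑ i ∈ Finset.range m, (m * (2 * p ^ 2) + 2 * r * p) := by
        refine Finset.sum_le_sum fun i _ => ?_
        rw [Finset.sum_add_distrib, Finset.sum_const, Finset.card_range, nsmul_eq_mul,
          ← Finset.sum_filter, Finset.sum_const, nsmul_eq_mul]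
        have : ((Finset.range m).filter
            (fun j => j ∈ Finset.Ico (i + 1 - r) (i + r))).card ≤ 2 * r := by
          calc _ ≤ (Finset.Ico (i + 1 - r) (i + r)).card :=
                Finset.card_le_card fun x hx => (Finset.mem_filter.1 hx).2
            _ ≤ _ := by rw [Nat.card_Ico]; omega
        have h2 : (((Finset.range m).filter
            (fun j => j ∈ Finset.Ico (i + 1 - r) (i + r))).card : ℝ) ≤ 2 * r := by
          exact_mod_cast this
        gcongr
    _ = _ := by
        rw [Finset.sum_const, Finset.card_range, nsmul_eq_mul]; ring

/-- the variance-type quantity -/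
noncomputable def vT {Ω : Type*} [MeasurableSpace Ω] (μ : Measure Ω) (T : Ω → Ω) (χ : Ω → ℝ)
    (t : ℝ) (m : ℕ) : ℝ :=
  ∫ ω, ((cT T χ t (Finset.range m) ω : ℝ) - m * μ.real {ω | t < χ ω}) ^ 2 ∂μ

lemma vT_le {Ω : Type*} [MeasurableSpace Ω] (μ : Measure Ω) [IsProbabilityMeasure μ]
    (T : Ω → Ω) (hT : MeasurePreserving T μ μ) (χ : Ω → ℝ)
    (hχ : Measurable χ) (r : ℕ) (ψ : ℝ) (hψ1 : ψ < 1)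
    (h : MixBound μ T χ r ψ) (t : ℝ) (m : ℕ) :
    vT μ T χ t m ≤
      2 * (m * μ.real {ω | t < χ ω}) ^ 2 + 2 * r * (m * μ.real {ω | t < χ ω}) := by
  refine le_trans ?_ (cT_second μ T hT χ hχ r ψ hψ1 h t m)
  have hmean := cT_mean μ T hT χ hχ t (Finset.range m)
  rw [Finset.card_range] at hmean
  set e := (m : ℝ) * μ.real {ω | t < χ ω} with he
  have i1 := cT_integrable μ T hT.measurable χ hχ t (Finset.range m) (fun x => (x : ℝ) ^ 2)
  have i2 := cT_integrable μ T hT.measurable χ hχ t (Finset.range m) (fun x => (x : ℝ))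
  have : vT μ T χ t m = ∫ ω, (cT T χ t (Finset.range m) ω : ℝ) ^ 2 ∂μ - e ^ 2 := by
    unfold vT
    rw [← he]
    have : ∀ ω, ((cT T χ t (Finset.range m) ω : ℝ) - e) ^ 2 =
        (cT T χ t (Finset.range m) ω : ℝ) ^ 2 - (2 * e * (cT T χ t (Finset.range m) ω : ℝ) - e ^ 2) :=
      fun ω => by ring
    simp_rw [this]
    have i3 : Integrable (fun ω => 2 * e * (cT T χ t (Finset.range m) ω : ℝ) - e ^ 2) μ :=
      (i2.const_mul _).sub (integrable_const _)
    rw [integral_sub i1 i3,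
      integral_sub (i2.const_mul _) (integrable_const _), integral_const_mul, hmean]
    simp
    ring
  rw [this]
  nlinarith [sq_nonneg e]

lemma abs_int_sq_le {Ω : Type*} [MeasurableSpace Ω] (μ : Measure Ω) [IsProbabilityMeasure μ]
    (f : Ω → ℝ) (h1 : Integrable (fun ω => |f ω|) μ) (h2 : Integrable (fun ω => f ω ^ 2) μ) :
    (∫ ω, |f ω| ∂μ) * (∫ ω, |f ω| ∂μ) ≤ ∫ ω, f ω ^ 2 ∂μ := by
  set a := ∫ ω, |f ω| ∂μ with ha
  have : 0 ≤ ∫ ω, (|f ω| - a) ^ 2 ∂μ := integral_nonneg fun ω => sq_nonneg _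
  have e : ∀ ω, (|f ω| - a) ^ 2 = f ω ^ 2 - (2 * a * |f ω| - a ^ 2) := fun ω => by
    rw [sub_sq, sq_abs]; ring
  simp_rw [e] at this
  have i3 : Integrable (fun ω => 2 * a * |f ω| - a ^ 2) μ :=
    (h1.const_mul _).sub (integrable_const _)
  rw [integral_sub h2 i3,
      integral_sub (h1.const_mul _) (integrable_const _), integral_const_mul, ← ha] at this
  simp at this
  nlinarith

lemma vT_double {Ω : Type*} [MeasurableSpace Ω] (μ : Measure Ω) [IsProbabilityMeasure μ]
    (T : Ω → Ω) (hT : MeasurePreserving T μ μ) (χ : Ω → ℝ)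
    (hχ : Measurable χ) (r : ℕ) (hr : 1 ≤ r) (ψ : ℝ) (hψ0 : 0 ≤ ψ)
    (h : MixBound μ T χ r ψ) (t : ℝ) (m : ℕ) (hm : 1 ≤ m) (η : ℝ) (hη : 0 < η) :
    vT μ T χ t (2 * m) ≤ (1 + η) * (2 * (1 + ψ)) * vT μ T χ t m + (1 + 1 / η) * r ^ 2 := by
  set p := μ.real {ω | t < χ ω} with hp
  set e := (m : ℝ) * p with he
  set s := Finset.range m with hs
  set s' := s.image (· + (m + r - 1)) with hs'
  have hs'_mem : ∀ j ∈ s', m + r ≤ j + 1 := by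
    intro j hj
    simp only [hs', Finset.mem_image] at hj
    obtain ⟨a, _, rfl⟩ := hj
    omega
  have hs'_eq : s' = Finset.Ico (m + r - 1) (2 * m + r - 1) := by
    rw [hs', hs, Finset.range_eq_Ico, Finset.image_add_right_Ico]
    congr 1 <;> omega
  have hcov := mix_cov μ T hT.measurable χ hχ r ψ h t m hm s s' (by simp [hs]) hs'_mem
    (fun x => (x : ℝ) - e) (fun x => (x : ℝ) - e)
  have hv : ∫ ω, ((cT T χ t s ω : ℝ) - e) ^ 2 ∂μ = vT μ T χ t m := rfl
  have hv' : ∫ ω, ((cT T χ t s' ω : ℝ) - e) ^ 2 ∂μ = vT μ T χ t m :=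
    cT_integral_shift μ T hT χ hχ t s _ (fun x => ((x : ℝ) - e) ^ 2)
  have ha' : ∫ ω, |(cT T χ t s' ω : ℝ) - e| ∂μ = ∫ ω, |(cT T χ t s ω : ℝ) - e| ∂μ :=
    cT_integral_shift μ T hT χ hχ t s _ (fun x => |(x : ℝ) - e|)
  have hz : ∫ ω, ((cT T χ t s ω : ℝ) - e) ∂μ = 0 := by
    rw [integral_sub (cT_integrable μ T hT.measurable χ hχ t s (fun x => (x : ℝ)))
      (integrable_const _), cT_mean μ T hT χ hχ]
    simp [hs, he, hp]
  have hI : ∀ (s : Finset ℕ) (φ : ℕ → ℝ), Integrable (fun ω => φ (cT T χ t s ω)) μ := fun s φ =>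
    cT_integrable μ T hT.measurable χ hχ t s φ
  have hI2 := cT_integrable2 μ T hT.measurable χ hχ t s s'
    (fun x => (x : ℝ) - e) (fun x => (x : ℝ) - e)
  have habs := abs_int_sq_le μ (fun ω => (cT T χ t s ω : ℝ) - e)
    (hI s (fun x => |(x : ℝ) - e|)) (hI s (fun x => ((x : ℝ) - e) ^ 2))
  change |∫ ω, ((cT T χ t s ω : ℝ) - e) * ((cT T χ t s' ω : ℝ) - e) ∂μ -
    (∫ ω, ((cT T χ t s ω : ℝ) - e) ∂μ) * ∫ ω, ((cT T χ t s' ω : ℝ) - e) ∂μ| ≤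
    ψ * ((∫ ω, |(cT T χ t s ω : ℝ) - e| ∂μ) * ∫ ω, |(cT T χ t s' ω : ℝ) - e| ∂μ) at hcov
  rw [ha', hz, zero_mul, sub_zero] at hcov
  have hcov2 : ∫ ω, ((cT T χ t s ω : ℝ) - e) * ((cT T χ t s' ω : ℝ) - e) ∂μ ≤
      ψ * vT μ T χ t m :=
    ((abs_le.1 hcov).2).trans (mul_le_mul_of_nonneg_left (by rw [← hv]; exact habs) hψ0)
  have hdiff : ∀ ω, |(cT T χ t (Finset.range (2 * m)) ω : ℝ) -
      cT T χ t s ω - cT T χ t s' ω| ≤ r := by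
    intro ω
    have e1 : Finset.range (2 * m) = s ∪ Finset.Ico m (2 * m) := by
      ext x; simp [hs]; omega
    have e2 := cntY_union (fun j ω => χ (T^[j] ω)) t s (Finset.Ico m (2 * m))
      (by rw [Finset.disjoint_left]; intro x; simp [hs]; omega) ω
    have e3 : Finset.Ico m (2 * m) ∪ Finset.Ico (2 * m) (2 * m + r - 1) =
        Finset.Ico m (m + r - 1) ∪ s' := by
      rw [hs'_eq]; ext x; simp; omega
    have e4 := cntY_union (fun j ω => χ (T^[j] ω)) t (Finset.Ico m (2 * m))
      (Finset.Ico (2 * m) (2 * m + r - 1))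
      (by rw [Finset.disjoint_left]; intro x; simp; omega) ω
    have e5 := cntY_union (fun j ω => χ (T^[j] ω)) t (Finset.Ico m (m + r - 1)) s'
      (by rw [Finset.disjoint_left, hs'_eq]; intro x; simp; omega) ω
    have e6 := cntY_le (fun j ω => χ (T^[j] ω)) t (Finset.Ico (2 * m) (2 * m + r - 1)) ω
    have e7 := cntY_le (fun j ω => χ (T^[j] ω)) t (Finset.Ico m (m + r - 1)) ω
    rw [Nat.card_Ico] at e6 e7
    rw [e1]
    simp only [cT]
    rw [e2]
    rw [e3, e5] at e4
    have e8 : (cntY (fun j ω => χ (T^[j] ω)) t (Finset.Ico m (2 * m)) ω) ≤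
      cntY (fun j ω => χ (T^[j] ω)) t s' ω + r := by omega
    have e9 : cntY (fun j ω => χ (T^[j] ω)) t s' ω ≤
      (cntY (fun j ω => χ (T^[j] ω)) t (Finset.Ico m (2 * m)) ω) + r := by omega
    have e8' : (cntY (fun j ω => χ (T^[j] ω)) t (Finset.Ico m (2 * m)) ω : ℝ) ≤
      cntY (fun j ω => χ (T^[j] ω)) t s' ω + r := by exact_mod_cast e8
    have e9' : (cntY (fun j ω => χ (T^[j] ω)) t s' ω : ℝ) ≤
      (cntY (fun j ω => χ (T^[j] ω)) t (Finset.Ico m (2 * m)) ω) + r := by exact_mod_cast e9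
    push_cast
    rw [abs_le]
    constructor <;> linarith
  have hpt : ∀ ω, ((cT T χ t (Finset.range (2 * m)) ω : ℝ) - (2 * m : ℕ) * p) ^ 2 ≤
      (1 + η) * (((cT T χ t s ω : ℝ) - e) ^ 2 + ((cT T χ t s' ω : ℝ) - e) ^ 2 +
        2 * (((cT T χ t s ω : ℝ) - e) * ((cT T χ t s' ω : ℝ) - e))) + (1 + 1 / η) * r ^ 2 := by
    intro ω
    have hd := hdiff ω
    set D := (cT T χ t (Finset.range (2 * m)) ω : ℝ) - cT T χ t s ω - cT T χ t s' ω with hD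
    set x := ((cT T χ t s ω : ℝ) - e) + ((cT T χ t s' ω : ℝ) - e) with hx
    have e1 : (cT T χ t (Finset.range (2 * m)) ω : ℝ) - (2 * m : ℕ) * p = x + D := by
      rw [hx, hD, he]; push_cast; ring
    have e2 : ((cT T χ t s ω : ℝ) - e) ^ 2 + ((cT T χ t s' ω : ℝ) - e) ^ 2 +
        2 * (((cT T χ t s ω : ℝ) - e) * ((cT T χ t s' ω : ℝ) - e)) = x ^ 2 := by
      rw [hx]; ring
    rw [e1, e2]
    have h1 : D ^ 2 ≤ (r : ℝ) ^ 2 := sq_le_sq' (abs_le.1 hd).1 (abs_le.1 hd).2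
    have h2 : (1 + η) * x ^ 2 + (1 + 1 / η) * D ^ 2 - (x + D) ^ 2 = (η * x - D) ^ 2 / η := by
      field_simp; ring
    have h3 : 0 ≤ (η * x - D) ^ 2 / η := by positivity
    have h4 : (1 + 1 / η) * D ^ 2 ≤ (1 + 1 / η) * r ^ 2 :=
      mul_le_mul_of_nonneg_left h1 (by positivity)
    linarith
  have iA := hI s (fun x => ((x : ℝ) - e) ^ 2)
  have iB := hI s' (fun x => ((x : ℝ) - e) ^ 2)
  calc vT μ T χ t (2 * m) ≤ ∫ ω, ((1 + η) * (((cT T χ t s ω : ℝ) - e) ^ 2 +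
        ((cT T χ t s' ω : ℝ) - e) ^ 2 +
        2 * (((cT T χ t s ω : ℝ) - e) * ((cT T χ t s' ω : ℝ) - e))) + (1 + 1 / η) * r ^ 2) ∂μ := by
        refine integral_mono (hI _ (fun x => ((x : ℝ) - (2 * m : ℕ) * p) ^ 2)) ?_ hpt
        exact (((iA.add iB).add (hI2.const_mul 2)).const_mul (1 + η)).add (integrable_const _)
    _ = (1 + η) * (vT μ T χ t m + vT μ T χ t m +
        2 * ∫ ω, ((cT T χ t s ω : ℝ) - e) * ((cT T χ t s' ω : ℝ) - e) ∂μ)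
          + (1 + 1 / η) * r ^ 2 := by
        have iC : Integrable (fun ω => ((cT T χ t s ω : ℝ) - e) ^ 2 +
          ((cT T χ t s' ω : ℝ) - e) ^ 2) μ := iA.add iB
        have iD : Integrable (fun ω => ((cT T χ t s ω : ℝ) - e) ^ 2 +
          ((cT T χ t s' ω : ℝ) - e) ^ 2 +
          2 * (((cT T χ t s ω : ℝ) - e) * ((cT T χ t s' ω : ℝ) - e))) μ :=
          iC.add (hI2.const_mul 2)
        rw [integral_add (iD.const_mul (1 + η)) (integrable_const _), integral_const_mul,
          integral_add iC (hI2.const_mul 2), integral_add iA iB, integral_const_mul, hv, hv']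
        simp
    _ ≤ _ := by nlinarith

lemma vT_pow {Ω : Type*} [MeasurableSpace Ω] (μ : Measure Ω) [IsProbabilityMeasure μ]
    (T : Ω → Ω) (hT : MeasurePreserving T μ μ) (χ : Ω → ℝ)
    (hχ : Measurable χ) (r : ℕ) (hr : 1 ≤ r) (ψ : ℝ) (hψ0 : 0 ≤ ψ)
    (h : MixBound μ T χ r ψ) (t : ℝ) (m : ℕ) (hm : 1 ≤ m) (η : ℝ) (hη : 0 < η) (K : ℕ) :
    vT μ T χ t (2 ^ K * m) + (1 + 1 / η) * r ^ 2 ≤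
      ((1 + η) * (2 * (1 + ψ))) ^ K * (vT μ T χ t m + (1 + 1 / η) * r ^ 2) := by
  induction K with
  | zero => simp
  | succ K ih =>
    have h1 := vT_double μ T hT χ hχ r hr ψ hψ0 h t (2 ^ K * m) (Nat.mul_pos (by positivity) hm) η hη
    have e : 2 ^ (K + 1) * m = 2 * (2 ^ K * m) := by ring
    rw [e]
    set θ := (1 + η) * (2 * (1 + ψ)) with hθ
    have hθ2 : 2 ≤ θ := by nlinarith [mul_nonneg hη.le hψ0]
    have hC : 0 ≤ (1 + 1 / η) * (r : ℝ) ^ 2 := by positivity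
    rw [pow_succ θ]
    have h2 := mul_le_mul_of_nonneg_left ih (by linarith : 0 ≤ θ)
    have h3 := mul_le_mul_of_nonneg_right hθ2 hC
    generalize (1 + 1 / η) * (r : ℝ) ^ 2 = C at *
    linarith

set_option maxHeartbeats 1000000 in
lemma conc {Ω : Type*} [MeasurableSpace Ω] (μ : Measure Ω) [IsProbabilityMeasure μ]
    (T : Ω → Ω) (hT : MeasurePreserving T μ μ) (χ : Ω → ℝ)
    (hχ : Measurable χ) (r : ℕ) (hr : 1 ≤ r) (ψ : ℝ) (hψ0 : 0 ≤ ψ) (hψ1 : ψ < 1)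
    (h : MixBound μ T χ r ψ) (q : ℝ) (hq0 : 0 < q) (hq1 : q < 1) (ε : ℝ) (hε : 0 < ε) :
    ∃ B₀ : ℝ, ∀ (n b : ℕ) (t : ℝ), B₀ ≤ b → n * μ.real {ω | t < χ ω} ≤ q * b →
      μ.real {ω | (b : ℝ) - 2 * r + 1 < (cT T χ t (Finset.range n) ω : ℝ)} ≤ ε := by
  set η := (1 - ψ) / (2 * (1 + ψ)) with hηd
  have hη : 0 < η := div_pos (by linarith) (by linarith)
  have hθ : (1 + η) * (2 * (1 + ψ)) = 3 + ψ := by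
    rw [hηd]; field_simp; ring
  set δ := (1 - q) / 2 with hδ
  have hδ0 : 0 < δ := by rw [hδ]; linarith
  set C := (1 + 1 / η) * (r : ℝ) ^ 2 with hC
  have hC0 : 0 ≤ C := by positivity
  obtain ⟨K, hK⟩ := exists_pow_lt_of_lt_one (show 0 < ε * δ ^ 2 / 13 by positivity)
    (show (3 + ψ) / 4 < 1 by linarith)
  have h2K : (0 : ℝ) < 2 ^ K := by positivity
  have hrr : (1 : ℝ) ≤ r := by exact_mod_cast hr
  refine ⟨2 ^ K * (r + C) + (2 * r + 2 ^ K) / δ, fun n b t hb hnp => ?_⟩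
  have hb1 : (2 : ℝ) ^ K * (r + C) ≤ b := by
    have : 0 ≤ (2 * r + 2 ^ K) / δ := by positivity
    linarith
  have hb2 : 2 * r + 2 ^ K ≤ δ * b := by
    have h0 : 0 ≤ (2 : ℝ) ^ K * (r + C) := by positivity
    have : (2 * r + 2 ^ K) / δ ≤ b := by linarith
    rw [div_le_iff₀ hδ0] at this
    linarith
  set p := μ.real {ω | t < χ ω} with hp
  have hp0 : 0 ≤ p := measureReal_nonneg
  have hp1 : p ≤ 1 := measureReal_le_one
  set x := (b : ℝ) / 2 ^ K with hx
  have hxb : x * 2 ^ K = b := by rw [hx]; field_simp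
  have hxr : r + C ≤ x := by rw [hx, le_div_iff₀ h2K]; linarith
  set m := n / 2 ^ K + 1 with hm
  have hmle : (m : ℝ) ≤ n / 2 ^ K + 1 := by
    rw [hm]; push_cast
    have := Nat.cast_div_le (α := ℝ) (m := n) (n := 2 ^ K)
    push_cast at this
    linarith
  have hnm : n ≤ 2 ^ K * m := by
    rw [hm]
    have := Nat.div_add_mod n (2 ^ K)
    have := Nat.mod_lt n (show 0 < 2 ^ K by positivity)
    rw [mul_add]; omega
  have hb0 : (0 : ℝ) ≤ b := Nat.cast_nonneg b
  have hmp : m * p ≤ q * x + 1 := by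
    calc m * p ≤ (n / 2 ^ K + 1) * p := mul_le_mul_of_nonneg_right hmle hp0
      _ = (n * p) / 2 ^ K + p := by ring
      _ ≤ (q * b) / 2 ^ K + 1 := by gcongr
      _ = _ := by rw [hx]; ring
  have hmp0 : 0 ≤ m * p := by positivity
  have hmpx : m * p ≤ 2 * x := by nlinarith
  have hv := vT_pow μ T hT χ hχ r hr ψ hψ0 h t m (Nat.succ_pos _) η hη K
  have hvm := vT_le μ T hT χ hχ r ψ hψ1 h t m
  rw [← hp] at hvm
  rw [hθ, ← hC] at hv
  have hvm2 : vT μ T χ t m + C ≤ 13 * x ^ 2 := by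
    have h1 : (m * p) ^ 2 ≤ (2 * x) ^ 2 := by gcongr
    have h2 : (r : ℝ) * (m * p) ≤ x * (2 * x) := by
      apply mul_le_mul <;> linarith
    have h3 : C ≤ x ^ 2 := by nlinarith
    nlinarith
  have hvK : vT μ T χ t (2 ^ K * m) ≤ ε * (δ * b) ^ 2 := by
    have h1 : (3 + ψ) ^ K * (vT μ T χ t m + C) ≤ (3 + ψ) ^ K * (13 * x ^ 2) := by gcongr
    have h2 : (3 + ψ) ^ K * (13 * x ^ 2) = ((3 + ψ) / 4) ^ K * 13 * b ^ 2 := by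
      have : (4 : ℝ) ^ K = 2 ^ K * 2 ^ K := by rw [← mul_pow]; norm_num
      rw [hx, div_pow, div_pow, this]; field_simp
    have h3 : ((3 + ψ) / 4) ^ K * 13 * b ^ 2 ≤ (ε * δ ^ 2 / 13) * 13 * (b : ℝ) ^ 2 := by gcongr
    have h4 : (ε * δ ^ 2 / 13) * 13 * (b : ℝ) ^ 2 = ε * (δ * b) ^ 2 := by ring
    linarith
  have hδb : 0 < δ * b := by linarith
  have hmk := mul_meas_ge_le_integral_of_nonneg (μ := μ)
    (f := fun ω => ((cT T χ t (Finset.range (2 ^ K * m)) ω : ℝ) - (2 ^ K * m : ℕ) * p) ^ 2)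
    (Eventually.of_forall fun ω => sq_nonneg _)
    (cT_integrable μ T hT.measurable χ hχ t (Finset.range (2 ^ K * m))
      (fun y => ((y : ℝ) - (2 ^ K * m : ℕ) * p) ^ 2)) ((δ * b) ^ 2)
  have hmk2 : (δ * b) ^ 2 * μ.real {ω | (δ * b) ^ 2 ≤
      ((cT T χ t (Finset.range (2 ^ K * m)) ω : ℝ) - (2 ^ K * m : ℕ) * p) ^ 2} ≤
      ε * (δ * b) ^ 2 := hmk.trans hvK
  have hmono : μ.real {ω | (b : ℝ) - 2 * r + 1 < (cT T χ t (Finset.range n) ω : ℝ)} ≤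
      μ.real {ω | (δ * b) ^ 2 ≤
      ((cT T χ t (Finset.range (2 ^ K * m)) ω : ℝ) - (2 ^ K * m : ℕ) * p) ^ 2} := by
    refine measureReal_mono fun ω hω => ?_
    simp only [Set.mem_ofPred_eq] at hω ⊢
    have h1 : (cT T χ t (Finset.range n) ω : ℝ) ≤ cT T χ t (Finset.range (2 ^ K * m)) ω := by
      exact_mod_cast cntY_mono _ _ _ _ (Finset.range_mono hnm) ω
    have h2 : ((2 ^ K * m : ℕ) : ℝ) * p ≤ q * b + 2 ^ K := by
      push_cast
      calc (2 : ℝ) ^ K * m * p = 2 ^ K * (m * p) := by ring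
        _ ≤ 2 ^ K * (q * x + 1) := by gcongr
        _ = q * (x * 2 ^ K) + 2 ^ K := by ring
        _ = _ := by rw [hxb]
    have h3 : δ * b ≤ (cT T χ t (Finset.range (2 ^ K * m)) ω : ℝ) - (2 ^ K * m : ℕ) * p := by
      have : q * b = b - 2 * (δ * b) := by rw [hδ]; ring
      linarith
    gcongr
  have hpos : 0 < (δ * b) ^ 2 := by positivity
  refine hmono.trans ?_
  refine le_of_mul_le_mul_left ?_ hpos
  linarith

lemma exp_moment {Ω : Type*} [MeasurableSpace Ω] (μ : Measure Ω) [IsProbabilityMeasure μ]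
    (T : Ω → Ω) (hT : MeasurePreserving T μ μ) (χ : Ω → ℝ)
    (hχ : Measurable χ) (r : ℕ) (hr : 1 ≤ r) (ψ : ℝ) (hψ1 : ψ < 1)
    (h : MixBound μ T χ r ψ) (t c : ℝ) (hc : 0 ≤ c) (l : ℕ) :
    ∫ ω, (1 + c) ^ (cT T χ t ((Finset.range l).image (r * ·)) ω) ∂μ ≤
      (1 + 2 * c * μ.real {ω | t < χ ω}) ^ l := by
  set p := μ.real {ω | t < χ ω} with hp
  have hp0 : 0 ≤ p := measureReal_nonneg
  induction l with
  | zero => simp [cntY]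
  | succ l ih =>
    set s := (Finset.range l).image (r * ·) with hs
    have hnot : Disjoint s {r * l} := by
      rw [Finset.disjoint_singleton_right, hs]
      simp only [Finset.mem_image, Finset.mem_range, not_exists, not_and]
      intro x hx hxe
      have := Nat.eq_of_mul_eq_mul_left (by omega) hxe
      omega
    have hset : (Finset.range (l + 1)).image (r * ·) = s ∪ {r * l} := by
      rw [Finset.range_add_one, Finset.image_insert, hs, Finset.insert_eq, Finset.union_comm]
    have hpt : ∀ ω, (1 + c) ^ (cT T χ t ((Finset.range (l + 1)).image (r * ·)) ω) =
        (1 + c) ^ (cT T χ t s ω) + c * ((1 + c) ^ (cT T χ t s ω) * (cT T χ t {r * l} ω : ℝ)) := by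
      intro ω
      rw [hset]
      simp only [cT]
      rw [cntY_union _ _ _ _ hnot, pow_add]
      have h1 := cntY_le (fun j ω => χ (T^[j] ω)) t {r * l} ω
      rw [Finset.card_singleton] at h1
      interval_cases (cntY (fun j ω => χ (T^[j] ω)) t {r * l} ω)
      · simp
      · simp; ring
    have i1 := cT_integrable μ T hT.measurable χ hχ t s (fun y => (1 + c) ^ y)
    have i2 := cT_integrable2 μ T hT.measurable χ hχ t s {r * l} (fun y => (1 + c) ^ y)
      (fun y => (y : ℝ))
    have hE0 : 0 ≤ ∫ ω, (1 + c) ^ (cT T χ t s ω) ∂μ :=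
      integral_nonneg fun ω => by positivity
    have hcov : ∫ ω, (1 + c) ^ (cT T χ t s ω) * (cT T χ t {r * l} ω : ℝ) ∂μ ≤
        2 * p * ∫ ω, (1 + c) ^ (cT T χ t s ω) ∂μ := by
      rcases Nat.eq_zero_or_pos l with h0 | hl
      · have hs0 : s = ∅ := by rw [hs, h0]; simp
        have hsing := cT_single μ T hT χ hχ t (r * l)
        simp only [hs0, cT, cntY, Finset.filter_empty, Finset.card_empty, pow_zero, one_mul] at *
        simp only [integral_const, probReal_univ, smul_eq_mul, mul_one]
        rw [hsing]; linarith
      · have h1 := mix_cov μ T hT.measurable χ hχ r ψ h t (r * (l - 1) + 1) (by omega) s {r * l}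
          (by
            intro j hj
            simp only [hs, Finset.mem_image, Finset.mem_range] at hj
            obtain ⟨a, ha, rfl⟩ := hj
            have : r * a ≤ r * (l - 1) := Nat.mul_le_mul_left r (by omega)
            omega)
          (by
            intro j hj
            rw [Finset.mem_singleton] at hj
            subst hj
            obtain ⟨l', rfl⟩ : ∃ l', l = l' + 1 := ⟨l - 1, by omega⟩
            simp only [Nat.add_sub_cancel, mul_add]; omega)
          (fun y => (1 + c) ^ y) (fun y => (y : ℝ))
        have habs : ∀ y : ℕ, |(1 + c) ^ y| = (1 + c) ^ y := fun y =>
          abs_of_nonneg (by positivity)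
        simp only [Nat.abs_cast, habs] at h1
        have e2 := cT_single μ T hT χ hχ t (r * l)
        simp only [cT] at e2 hE0 ⊢
        rw [e2] at h1
        have h2 := (abs_le.1 h1).2
        have h3 := mul_nonneg hE0 hp0
        nlinarith
    simp_rw [hpt]
    rw [integral_add i1 (i2.const_mul c), integral_const_mul, pow_succ]
    calc _ ≤ ∫ ω, (1 + c) ^ (cT T χ t s ω) ∂μ +
          c * (2 * p * ∫ ω, (1 + c) ^ (cT T χ t s ω) ∂μ) := by gcongr
      _ = (∫ ω, (1 + c) ^ (cT T χ t s ω) ∂μ) * (1 + 2 * c * p) := by ring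
      _ ≤ _ := by
        apply mul_le_mul_of_nonneg_right ih
        positivity

lemma large_dev {Ω : Type*} [MeasurableSpace Ω] (μ : Measure Ω) [IsProbabilityMeasure μ]
    (T : Ω → Ω) (hT : MeasurePreserving T μ μ) (χ : Ω → ℝ)
    (hχ : Measurable χ) (r : ℕ) (hr : 1 ≤ r) (ψ : ℝ) (hψ1 : ψ < 1)
    (h : MixBound μ T χ r ψ) (t w : ℝ) (hw : 0 < w) (n b M : ℕ) (hb : 4 * r ≤ b)
    (hbM : 2 * r * M ≤ b) (hnp : n * μ.real {ω | t < χ ω} ≤ w * b) :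
    μ.real {ω | (b : ℝ) - 2 * r + 1 < (cT T χ t (Finset.range n) ω : ℝ)} ≤
      r * (Real.exp (4 * r) * w) ^ M := by
  have hrr : (1 : ℝ) ≤ r := by exact_mod_cast hr
  set V := Real.exp (4 * r) * w with hV
  have hV0 : 0 < V := by positivity
  rcases le_or_gt 1 V with hV1 | hV1
  · have h1 : (1 : ℝ) ≤ V ^ M := one_le_pow₀ hV1
    have h2 : μ.real {ω | (b : ℝ) - 2 * r + 1 < (cT T χ t (Finset.range n) ω : ℝ)} ≤ 1 :=
      measureReal_le_one
    nlinarith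
  set p := μ.real {ω | t < χ ω} with hp
  have hp0 : 0 ≤ p := measureReal_nonneg
  set s := (Finset.range n).image (r * ·) with hs
  set y := (b : ℝ) / (2 * r) with hy
  have hy0 : 0 ≤ y := by positivity
  have hyb : y * (2 * r) = b := by rw [hy]; field_simp
  -- one residue class
  have hcls : μ.real {ω | y ≤ (cT T χ t s ω : ℝ)} ≤ V ^ M := by
    set c := 1 / w with hc
    have hc0 : 0 < c := by positivity
    have hE := exp_moment μ T hT χ hχ r hr ψ hψ1 h t c hc0.le n
    rw [← hp, ← hs] at hE
    have hE2 : (1 + 2 * c * p) ^ n ≤ Real.exp (2 * b) := by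
      have h1 : 1 + 2 * c * p ≤ Real.exp (2 * c * p) := by
        have := Real.add_one_le_exp (2 * c * p); linarith
      calc (1 + 2 * c * p) ^ n ≤ Real.exp (2 * c * p) ^ n := by gcongr
        _ = Real.exp (2 * c * (n * p)) := by rw [← Real.exp_nat_mul]; congr 1; ring
        _ ≤ Real.exp (2 * c * (w * b)) := by gcongr
        _ = _ := by congr 1; rw [hc]; field_simp
    have hmk := mul_meas_ge_le_integral_of_nonneg (μ := μ)
      (f := fun ω => (1 + c) ^ (cT T χ t s ω))
      (Eventually.of_forall fun ω => by positivity)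
      (cT_integrable μ T hT.measurable χ hχ t s (fun y => (1 + c) ^ y)) (c ^ y)
    have hsub : μ.real {ω | y ≤ (cT T χ t s ω : ℝ)} ≤
        μ.real {ω | c ^ y ≤ (1 + c) ^ (cT T χ t s ω)} := by
      refine measureReal_mono fun ω hω => ?_
      simp only [Set.mem_ofPred_eq] at hω ⊢
      calc c ^ y ≤ (1 + c) ^ y := Real.rpow_le_rpow hc0.le (by linarith) hy0
        _ ≤ (1 + c) ^ (cT T χ t s ω : ℝ) :=
          Real.rpow_le_rpow_of_exponent_le (by linarith) hω
        _ = _ := Real.rpow_natCast _ _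
    have hcy : 0 < c ^ y := Real.rpow_pos_of_pos hc0 y
    have h1 : c ^ y * μ.real {ω | y ≤ (cT T χ t s ω : ℝ)} ≤ Real.exp (2 * b) :=
      (mul_le_mul_of_nonneg_left hsub hcy.le).trans (hmk.trans (hE.trans hE2))
    have h2 : μ.real {ω | y ≤ (cT T χ t s ω : ℝ)} ≤ V ^ y := by
      refine le_of_mul_le_mul_left (h1.trans (le_of_eq ?_)) hcy
      rw [← Real.mul_rpow hc0.le hV0.le]
      have : c * V = Real.exp (4 * r) := by rw [hc, hV]; field_simp
      rw [this, ← Real.exp_mul, ← hyb]; congr 1; ring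
    refine h2.trans ?_
    rw [← Real.rpow_natCast]
    refine Real.rpow_le_rpow_of_exponent_ge hV0 hV1.le ?_
    rw [hy, le_div_iff₀ (by positivity)]
    have : ((2 * r * M : ℕ) : ℝ) ≤ b := by exact_mod_cast hbM
    push_cast at this; linarith
  -- union over the residue classes
  have hcl : ∀ i, μ.real {ω | y ≤ (cT T χ t (s.image (· + i)) ω : ℝ)} ≤ V ^ M := by
    intro i
    have : {ω | y ≤ (cT T χ t (s.image (· + i)) ω : ℝ)} =
        T^[i] ⁻¹' {ω | y ≤ (cT T χ t s ω : ℝ)} := by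
      ext ω; simp only [Set.mem_ofPred_eq, cT_shift, Set.mem_preimage]
    rw [this, measureReal_def, (hT.iterate i).measure_preimage, ← measureReal_def]
    · exact hcls
    · have hmeas : Measurable fun ω => (cT T χ t s ω : ℝ) :=
        measurable_from_nat.comp (cT_measurable T hT.measurable χ hχ t s)
      exact (measurableSet_le measurable_const hmeas).nullMeasurableSet
  have hsub : {ω | (b : ℝ) - 2 * r + 1 < (cT T χ t (Finset.range n) ω : ℝ)} ⊆
      ⋃ i ∈ Finset.range r, {ω | y ≤ (cT T χ t (s.image (· + i)) ω : ℝ)} := by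
    intro ω hω
    simp only [Set.mem_ofPred_eq] at hω
    by_contra hcon
    simp only [Set.mem_iUnion, Set.mem_ofPred_eq, not_exists, not_le] at hcon
    have h1 : (cT T χ t (Finset.range n) ω : ℝ) ≤
        ∑ i ∈ Finset.range r, (cT T χ t (s.image (· + i)) ω : ℝ) := by
      have hsubset : Finset.range n ⊆ (Finset.range r).biUnion fun i => s.image (· + i) := by
        intro x hx
        rw [Finset.mem_range] at hx
        simp only [Finset.mem_biUnion, Finset.mem_image, Finset.mem_range, hs]
        refine ⟨x % r, Nat.mod_lt _ (by omega), r * (x / r), ⟨x / r, ?_, rfl⟩,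
          Nat.div_add_mod x r⟩
        exact (Nat.div_le_self x r).trans_lt hx
      have h2 : cT T χ t (Finset.range n) ω ≤
          ∑ i ∈ Finset.range r, cT T χ t (s.image (· + i)) ω := by
        refine (cntY_mono _ _ _ _ hsubset ω).trans ?_
        simp only [cT, cntY, Finset.filter_biUnion]
        exact Finset.card_biUnion_le
      exact_mod_cast h2
    have h2 : ∑ i ∈ Finset.range r, (cT T χ t (s.image (· + i)) ω : ℝ) ≤
        ∑ i ∈ Finset.range r, y := Finset.sum_le_sum fun i hi => (hcon i hi).le
    rw [Finset.sum_const, Finset.card_range, nsmul_eq_mul] at h2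
    have h3 : (4 * r : ℝ) ≤ b := by exact_mod_cast hb
    nlinarith
  calc _ ≤ μ.real (⋃ i ∈ Finset.range r, {ω | y ≤ (cT T χ t (s.image (· + i)) ω : ℝ)}) :=
        measureReal_mono hsub (measure_ne_top _ _)
    _ ≤ ∑ i ∈ Finset.range r, μ.real {ω | y ≤ (cT T χ t (s.image (· + i)) ω : ℝ)} :=
        measureReal_biUnion_finset_le _ _
    _ ≤ ∑ i ∈ Finset.range r, V ^ M := Finset.sum_le_sum fun i _ => hcl i
    _ = _ := by simp

lemma tail_pos_decay {Ω : Type*} [MeasurableSpace Ω] (μ : Measure Ω) (χ : Ω → ℝ)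
    (L : ℝ → ℝ) (hL : SlowlyVarying L) (hLpos : ∀ x : ℝ, 0 < x → 0 < L x)
    {α : ℝ} (hα0 : 0 < α)
    (htail : ∀ x : ℝ, 0 < x → μ.real {ω | x < χ ω} = L x / x ^ α) :
    ∃ q x₀ : ℝ, 0 < q ∧ q < 1 ∧ 0 < x₀ ∧ ∀ x, x₀ ≤ x →
      μ.real {ω | 2 * x < χ ω} ≤ q * μ.real {ω | x < χ ω} := by
  have h2 : (1 : ℝ) < 2 ^ α := Real.one_lt_rpow (by norm_num) hα0
  have h2p : (0 : ℝ) < 2 ^ α := by positivity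
  set c : ℝ := (1 + 2 ^ α) / 2 with hc
  have hc1 : 1 < c := by rw [hc]; linarith
  have hc2 : c < 2 ^ α := by rw [hc]; linarith
  have hev := (hL 2 (by norm_num)).eventually_lt_const hc1
  obtain ⟨x1, hx1⟩ := eventually_atTop.1 hev
  refine ⟨c / 2 ^ α, max x1 1, by positivity, (div_lt_one h2p).2 hc2, by positivity, ?_⟩
  intro x hx
  have hx0 : 0 < x := lt_of_lt_of_le (by positivity) hx
  have h3 := hx1 x ((le_max_left _ _).trans hx)
  rw [htail _ (by positivity), htail x hx0, Real.mul_rpow (by norm_num) hx0.le]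
  have hLx := hLpos x hx0
  rw [div_lt_iff₀ hLx] at h3
  have hxa : 0 < x ^ α := Real.rpow_pos_of_pos hx0 α
  calc L (2 * x) / (2 ^ α * x ^ α) ≤ (c * L x) / (2 ^ α * x ^ α) := by gcongr
    _ = _ := by field_simp

noncomputable def mT {Ω : Type*} [MeasurableSpace Ω] (μ : Measure Ω) (χ : Ω → ℝ) (f : ℝ) : ℝ :=
  ∫ ω, (if χ ω ≤ f then χ ω else 0) ∂μ

lemma trunc_measurable {Ω : Type*} [MeasurableSpace Ω] (χ : Ω → ℝ)
    (hχ : Measurable χ) (f : ℝ) : Measurable (fun ω => if χ ω ≤ f then χ ω else 0) :=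
  Measurable.ite (measurableSet_le hχ measurable_const) hχ measurable_const

lemma trunc_integrable {Ω : Type*} [MeasurableSpace Ω] (μ : Measure Ω) [IsProbabilityMeasure μ]
    (χ : Ω → ℝ) (hχ : Measurable χ) (h0 : ∀ ω, 0 ≤ χ ω) (f : ℝ) :
    Integrable (fun ω => if χ ω ≤ f then χ ω else 0) μ := by
  refine Integrable.of_bound (trunc_measurable χ hχ f).aestronglyMeasurable |f|
    (Eventually.of_forall fun ω => ?_)
  rw [Real.norm_eq_abs]
  split_ifs with h
  · rw [abs_of_nonneg (h0 ω)]; exact h.trans (le_abs_self f)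
  · simp

lemma integral_truncSumN {Ω : Type*} [MeasurableSpace Ω] (μ : Measure Ω) [IsProbabilityMeasure μ]
    (T : Ω → Ω) (hT : MeasurePreserving T μ μ)
    (χ : Ω → ℝ) (hχ : Measurable χ) (h0 : ∀ ω, 0 ≤ χ ω) (n : ℕ) (f : ℝ) :
    ∫ ω, truncSumN T χ n f ω ∂μ = n * mT μ χ f := by
  unfold truncSumN mT
  have hI := trunc_integrable μ χ hχ h0 f
  have hk : ∀ k : ℕ, Integrable (fun ω => if χ (T^[k] ω) ≤ f then χ (T^[k] ω) else 0) μ :=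
    fun k => ((hT.iterate k).integrable_comp hI.aestronglyMeasurable).2 hI
  rw [integral_finsetSum _ fun k _ => hk k]
  have : ∀ k : ℕ, ∫ ω, (if χ (T^[k] ω) ≤ f then χ (T^[k] ω) else 0) ∂μ =
      ∫ ω, (if χ ω ≤ f then χ ω else 0) ∂μ := by
    intro k
    have h := integral_map (μ := μ) (hT.iterate k).measurable.aemeasurable
      (f := fun ω => if χ ω ≤ f then χ ω else 0) (by
        rw [(hT.iterate k).map_eq]; exact hI.aestronglyMeasurable)
    rw [(hT.iterate k).map_eq] at h
    exact h.symm
  simp [this]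

lemma mT_double {Ω : Type*} [MeasurableSpace Ω] (μ : Measure Ω) [IsProbabilityMeasure μ]
    (χ : Ω → ℝ) (hχ : Measurable χ) (h0 : ∀ ω, 0 ≤ χ ω) (f : ℝ) (hf : 0 < f) :
    mT μ χ (2 * f) ≤ mT μ χ f + 2 * f * μ.real {ω | f < χ ω} := by
  unfold mT
  have hm : MeasurableSet {ω | f < χ ω} := measurableSet_lt measurable_const hχ
  have h1 : 2 * f * μ.real {ω | f < χ ω} =
      ∫ ω, {ω | f < χ ω}.indicator (fun _ => 2 * f) ω ∂μ := by
    rw [integral_indicator_const _ hm, smul_eq_mul, mul_comm]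
  have hi := (integrable_const (μ := μ) (2 * f)).indicator hm
  rw [h1, ← integral_add (trunc_integrable μ χ hχ h0 f) hi]
  refine integral_mono (trunc_integrable μ χ hχ h0 _)
    ((trunc_integrable μ χ hχ h0 f).add hi) fun ω => ?_
  have := h0 ω
  simp only [Set.indicator_apply, Set.mem_ofPred_eq]
  split_ifs <;> linarith

lemma mT_lower {Ω : Type*} [MeasurableSpace Ω] (μ : Measure Ω) [IsProbabilityMeasure μ]
    (χ : Ω → ℝ) (hχ : Measurable χ) (h0 : ∀ ω, 0 ≤ χ ω) (f : ℝ) (hf : 0 < f) :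
    f / 2 * (μ.real {ω | f / 2 < χ ω} - μ.real {ω | f < χ ω}) ≤ mT μ χ f := by
  unfold mT
  have hm : MeasurableSet {ω | f < χ ω} := measurableSet_lt measurable_const hχ
  have hm2 : MeasurableSet {ω | f / 2 < χ ω} := measurableSet_lt measurable_const hχ
  have h1 : ∀ g, MeasurableSet {ω | g < χ ω} → f / 2 * μ.real {ω | g < χ ω} =
      ∫ ω, {ω | g < χ ω}.indicator (fun _ => f / 2) ω ∂μ := fun g hg => by
    rw [integral_indicator_const _ hg, smul_eq_mul, mul_comm]
  have hi := (integrable_const (μ := μ) (f / 2)).indicator hm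
  have hi2 := (integrable_const (μ := μ) (f / 2)).indicator hm2
  rw [mul_sub, h1 _ hm, h1 _ hm2, ← integral_sub hi2 hi]
  refine integral_mono (hi2.sub hi) (trunc_integrable μ χ hχ h0 _) fun ω => ?_
  have := h0 ω
  simp only [Set.indicator_apply, Set.mem_ofPred_eq]
  split_ifs <;> linarith

lemma mT_pow {Ω : Type*} [MeasurableSpace Ω] (μ : Measure Ω) [IsProbabilityMeasure μ]
    (χ : Ω → ℝ) (hχ : Measurable χ) (h0 : ∀ ω, 0 ≤ χ ω)
    (hpos : ∀ x, 0 < x → 0 < μ.real {ω | x < χ ω})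
    (q x₀ : ℝ) (hq0 : 0 < q) (hq1 : q < 1) (hx₀ : 0 < x₀)
    (hdec : ∀ x, x₀ ≤ x → μ.real {ω | 2 * x < χ ω} ≤ q * μ.real {ω | x < χ ω}) :
    ∃ A : ℝ, 1 ≤ A ∧ ∀ f, 2 * x₀ ≤ f → 0 < mT μ χ f ∧
      ∀ k : ℕ, mT μ χ (2 ^ k * f) ≤ A ^ k * mT μ χ f := by
  have key : ∀ f, 2 * x₀ ≤ f → (1 - q) / 2 * (f * μ.real {ω | f < χ ω}) ≤ mT μ χ f := by
    intro f hf
    have h1 := mT_lower μ χ hχ h0 f (by linarith)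
    have h2 := hdec (f / 2) (by linarith)
    rw [show 2 * (f / 2) = f by ring] at h2
    have hD := hpos (f / 2) (by linarith)
    have hDf := hpos f (by linarith)
    refine le_trans ?_ h1
    have h3 : (1 - q) * μ.real {ω | f < χ ω} ≤
        μ.real {ω | f / 2 < χ ω} - μ.real {ω | f < χ ω} := by
      have : μ.real {ω | f < χ ω} ≤ μ.real {ω | f / 2 < χ ω} := by nlinarith
      nlinarith
    have h4 := mul_le_mul_of_nonneg_left h3 (show 0 ≤ f / 2 by linarith)
    linarith
  have hq' : 0 < 1 - q := by linarith
  refine ⟨1 + 4 / (1 - q), by have : 0 < 4 / (1 - q) := by positivity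
                              linarith, fun f hf => ⟨?_, fun k => ?_⟩⟩
  · have h1 := key f hf
    have hf0 : 0 < f := by linarith
    have := hpos f hf0
    exact lt_of_lt_of_le (by positivity) h1
  · induction k with
    | zero => simp
    | succ k ih =>
      have h2k : (1 : ℝ) ≤ 2 ^ k := one_le_pow₀ (by norm_num)
      have hf0 : 0 < f := by linarith
      have hF : 2 * x₀ ≤ 2 ^ k * f := by nlinarith
      have h1 := mT_double μ χ hχ h0 (2 ^ k * f) (by positivity)
      have h2 := key _ hF
      have e : (2 : ℝ) ^ (k + 1) * f = 2 * (2 ^ k * f) := by ring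
      rw [e]
      set G := (2 : ℝ) ^ k * f
      have h3 : 2 * G * μ.real {ω | G < χ ω} ≤ 4 / (1 - q) * mT μ χ G := by
        calc 2 * G * μ.real {ω | G < χ ω} =
            4 / (1 - q) * ((1 - q) / 2 * (G * μ.real {ω | G < χ ω})) := by field_simp; ring
          _ ≤ _ := by gcongr
      calc mT μ χ (2 * G) ≤ (1 + 4 / (1 - q)) * mT μ χ G := by linarith
        _ ≤ (1 + 4 / (1 - q)) * ((1 + 4 / (1 - q)) ^ k * mT μ χ f) := by gcongr
        _ = _ := by ring

lemma distF_eq_cdf {Ω : Type*} [MeasurableSpace Ω] (μ : Measure Ω) [IsProbabilityMeasure μ]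
    (χ : Ω → ℝ) (hχ : Measurable χ) (x : ℝ) :
    distF μ χ x = ProbabilityTheory.cdf (μ.map χ) x := by
  haveI : IsProbabilityMeasure (μ.map χ) := Measure.isProbabilityMeasure_map hχ.aemeasurable
  rw [ProbabilityTheory.cdf_eq_real, Measure.real, Measure.map_apply hχ measurableSet_Iic]
  rfl

lemma distF_tail {Ω : Type*} [MeasurableSpace Ω] (μ : Measure Ω) [IsProbabilityMeasure μ]
    (χ : Ω → ℝ) (hχ : Measurable χ) (x : ℝ) :
    μ.real {ω | x < χ ω} = 1 - distF μ χ x := by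
  have h := probReal_compl_eq_one_sub (μ := μ) (measurableSet_le hχ (measurable_const (a := x)))
  have e : {ω | χ ω ≤ x}ᶜ = {ω | x < χ ω} := by ext; simp
  rw [e] at h
  exact h

lemma genInv_spec {Ω : Type*} [MeasurableSpace Ω] (μ : Measure Ω) [IsProbabilityMeasure μ]
    (χ : Ω → ℝ) (hχ : Measurable χ) (h0 : ∀ ω, 0 ≤ χ ω) (y : ℝ) (hy0 : 0 < y) (hy1 : y < 1) :
    y ≤ distF μ χ (genInv (distF μ χ) y) ∧
      ∀ x, distF μ χ x < y → x ≤ genInv (distF μ χ) y := by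
  have hmono : Monotone (distF μ χ) := by
    intro a c hac
    rw [distF_eq_cdf μ χ hχ, distF_eq_cdf μ χ hχ]
    exact ProbabilityTheory.monotone_cdf _ hac
  have htop : Tendsto (distF μ χ) atTop (𝓝 1) := by
    rw [show distF μ χ = ProbabilityTheory.cdf (μ.map χ) from
      funext (distF_eq_cdf μ χ hχ)]
    exact ProbabilityTheory.tendsto_cdf_atTop _
  have hne : {x : ℝ | y ≤ distF μ χ x}.Nonempty := by
    obtain ⟨x, hx⟩ := (htop.eventually_const_lt hy1).exists
    exact ⟨x, hx.le⟩
  have hlow : ∀ x, distF μ χ x < y → ∀ z ∈ {x : ℝ | y ≤ distF μ χ x}, x ≤ z := by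
    intro x hx z hz
    by_contra hcon
    exact absurd (hmono (not_le.1 hcon).le) (not_le.2 (lt_of_lt_of_le hx hz))
  have hneg : distF μ χ (-1) < y := by
    have : {ω | χ ω ≤ -1} = ∅ := by
      ext ω; simp only [Set.mem_ofPred_eq, Set.mem_empty_iff_false, iff_false, not_le]
      linarith [h0 ω]
    simp [distF, this, hy0]
  have hbdd : BddBelow {x : ℝ | y ≤ distF μ χ x} := ⟨-1, fun z hz => hlow _ hneg z hz⟩
  refine ⟨?_, fun x hx => le_csInf hne (hlow x hx)⟩
  set g := genInv (distF μ χ) y with hg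
  have hrc : Tendsto (distF μ χ) (𝓝[>] g) (𝓝 (distF μ χ g)) := by
    rw [show distF μ χ = ProbabilityTheory.cdf (μ.map χ) from
      funext (distF_eq_cdf μ χ hχ)]
    exact ((ProbabilityTheory.cdf (μ.map χ)).right_continuous g).mono Set.Ioi_subset_Ici_self
  refine ge_of_tendsto hrc ?_
  filter_upwards [self_mem_nhdsWithin] with x hx
  obtain ⟨z, hz, hzx⟩ := exists_lt_of_csInf_lt hne (hx : sInf _ < x)
  exact le_trans hz (hmono hzx.le)

lemma gSeq_spec {Ω : Type*} [MeasurableSpace Ω] (μ : Measure Ω) [IsProbabilityMeasure μ]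
    (χ : Ω → ℝ) (hχ : Measurable χ) (h0 : ∀ ω, 0 ≤ χ ω)
    (hpos : ∀ x, 0 < x → 0 < μ.real {ω | x < χ ω})
    (b : ℕ → ℕ) (hb : Tendsto b atTop atTop)
    (hbo : Tendsto (fun n => (b n : ℝ) / (n : ℝ)) atTop (𝓝 0)) (X : ℝ) :
    ∀ᶠ n in atTop, X ≤ gSeq μ χ b n ∧ n * μ.real {ω | gSeq μ χ b n < χ ω} ≤ b n := by
  have hX : 0 < μ.real {ω | max X 1 < χ ω} := hpos _ (by positivity)
  filter_upwards [hb.eventually_ge_atTop 2, eventually_ge_atTop 1,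
    hbo.eventually_lt_const one_pos, hbo.eventually_lt_const hX] with n hb2 hn h1 h2
  have hn0 : (0 : ℝ) < n := by exact_mod_cast hn
  have hbr : (1 : ℝ) < b n := by exact_mod_cast hb2
  have hz : (b n : ℝ) ^ ((2 : ℝ) / 3) < b n := by
    conv_rhs => rw [← Real.rpow_one (b n : ℝ)]
    exact Real.rpow_lt_rpow_of_exponent_lt hbr (by norm_num)
  have hz0 : 0 ≤ (b n : ℝ) ^ ((2 : ℝ) / 3) := by positivity
  set d := ((b n : ℝ) - (b n : ℝ) ^ ((2 : ℝ) / 3)) / n with hd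
  have hd0 : 0 < d := div_pos (by linarith) hn0
  have hdle : d ≤ b n / n := by rw [hd]; gcongr; linarith
  obtain ⟨hs1, hs2⟩ := genInv_spec μ χ hχ h0 (1 - d) (by linarith) (by linarith)
  have hg : gSeq μ χ b n = genInv (distF μ χ) (1 - d) := rfl
  rw [← hg] at hs1 hs2
  constructor
  · refine (le_max_left X 1).trans (hs2 _ ?_)
    rw [distF_tail μ χ hχ] at h2
    linarith
  · have : μ.real {ω | gSeq μ χ b n < χ ω} ≤ b n / n := by
      rw [distF_tail μ χ hχ]; linarith
    rw [le_div_iff₀ hn0] at this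
    linarith

lemma card_filter_Icc_eq {Ω : Type*} (T : Ω → Ω) (χ : Ω → ℝ) (t : ℝ) (n : ℕ) (ω : Ω) :
    ((Finset.Icc 1 n).filter fun j => t < χ (T^[j - 1] ω)).card =
      cT T χ t (Finset.range n) ω := by
  have e : Finset.Icc 1 n = (Finset.range n).image (· + 1) := by
    ext x; simp only [Finset.mem_Icc, Finset.mem_image, Finset.mem_range]
    exact ⟨fun h => ⟨x - 1, by omega, by omega⟩, fun ⟨a, ha, hx⟩ => by omega⟩
  rw [e, Finset.filter_image, Finset.card_image_of_injective _ (add_left_injective 1)]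
  rfl

theorem sum_truncated_Phi_is_little_o
    {Ω : Type*} [MeasurableSpace Ω] (T : Ω → Ω) (μ : Measure Ω)
    {F : Type*} [NormedRing F] [NormedAlgebra ℝ F] [CompleteSpace F]
    (ι : F →ₐ[ℝ] Ω → ℝ) (χ : Ω → ℝ)
    (hD : PropertyD T μ ι χ)
    (L : ℝ → ℝ) (hL : SlowlyVarying L) (hLpos : ∀ x : ℝ, 0 < x → 0 < L x)
    {α : ℝ} (hα0 : 0 < α) (hα1 : α < 1)
    (htail : ∀ x : ℝ, 0 < x → (μ {ω | x < χ ω}).toReal = L x / x ^ α)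
    (b : ℕ → ℕ) (hb : Tendsto b atTop atTop)
    (hbo : Tendsto (fun n => (b n : ℝ) / (n : ℝ)) atTop (𝓝 0))
    (r : ℕ) (hr1 : 1 ≤ r) (hrψ : psiCoeff μ T χ r < 1)
    (hrmin : ∀ m : ℕ, 1 ≤ m → m < r → 1 ≤ psiCoeff μ T χ m)
    :
    Tendsto (fun n =>
      (∑' k : ℕ, (∫ ω, truncSumN T χ n (2 ^ (k + 2) * gSeq μ χ b n) ω ∂μ) *
        (μ {ω | (b n : ℝ) - 2 * r + 1 <
          (((Finset.Icc 1 n).filter fun j =>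
            2 ^ (k + 1) * gSeq μ χ b n < χ (T^[j - 1] ω)).card : ℝ)}).toReal) /
      ∫ ω, truncSumN T χ n (gSeq μ χ b n) ω ∂μ) atTop (𝓝 0) := by
  haveI : IsProbabilityMeasure μ := hD.prob
  have hT := hD.invariant
  have hχ := hD.chi_meas
  have h0 := hD.chi_nonneg
  have htail' : ∀ x : ℝ, 0 < x → μ.real {ω | x < χ ω} = L x / x ^ α := htail
  have hpos : ∀ x, 0 < x → 0 < μ.real {ω | x < χ ω} := by
    intro x hx
    rw [htail' x hx]
    exact div_pos (hLpos x hx) (Real.rpow_pos_of_pos hx α)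
  have hmix := mixBound_of_psi μ T χ r hrψ
  set ψ := (psiCoeff μ T χ r).toReal with hψ
  have hψ0 : 0 ≤ ψ := ENNReal.toReal_nonneg
  have hψ1 : ψ < 1 := by
    have := (ENNReal.toReal_lt_toReal hrψ.ne_top ENNReal.one_ne_top).2 hrψ
    simpa using this
  obtain ⟨q, x₀, hq0, hq1, hx₀, hdec⟩ := tail_pos_decay μ χ L hL hLpos hα0 htail'
  obtain ⟨A, hA1, hA⟩ := mT_pow μ χ hχ h0 hpos q x₀ hq0 hq1 hx₀ hdec
  have hA0 : 0 < A := by linarith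
  obtain ⟨M, hM⟩ := exists_pow_lt_of_lt_one (show 0 < 1 / A by positivity) hq1
  have hAq : A * q ^ M < 1 := by
    rw [lt_div_iff₀ hA0] at hM; linarith
  have hdecpow : ∀ g, x₀ ≤ g → ∀ k : ℕ,
      μ.real {ω | 2 ^ k * g < χ ω} ≤ q ^ k * μ.real {ω | g < χ ω} := by
    intro g hg k
    induction k with
    | zero => simp
    | succ k ih =>
      have h2k : (1 : ℝ) ≤ 2 ^ k := one_le_pow₀ (by norm_num)
      have h1 := hdec (2 ^ k * g) (by nlinarith)
      rw [show (2 : ℝ) ^ (k + 1) * g = 2 * (2 ^ k * g) by ring]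
      calc _ ≤ q * μ.real {ω | 2 ^ k * g < χ ω} := h1
        _ ≤ q * (q ^ k * μ.real {ω | g < χ ω}) := by gcongr
        _ = _ := by ring
  set P : ℕ → ℕ → ℝ := fun n k => μ.real {ω | (b n : ℝ) - 2 * r + 1 <
    (cT T χ (2 ^ (k + 1) * gSeq μ χ b n) (Finset.range n) ω : ℝ)} with hP
  have hP0 : ∀ n k, 0 ≤ P n k := fun n k => measureReal_nonneg
  set f : ℕ → ℕ → ℝ := fun n k =>
    (n * mT μ χ (2 ^ (k + 2) * gSeq μ χ b n)) * P n k / (n * mT μ χ (gSeq μ χ b n)) with hf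
  -- good indices
  have hgood : ∀ᶠ n in atTop, 2 * x₀ ≤ gSeq μ χ b n ∧
      n * μ.real {ω | gSeq μ χ b n < χ ω} ≤ b n :=
    gSeq_spec μ χ hχ h0 hpos b hb hbo _
  have hnp : ∀ n, (2 * x₀ ≤ gSeq μ χ b n ∧ n * μ.real {ω | gSeq μ χ b n < χ ω} ≤ b n) →
      ∀ k : ℕ, n * μ.real {ω | 2 ^ k * gSeq μ χ b n < χ ω} ≤ q ^ k * b n := by
    intro n hn k
    calc n * μ.real {ω | 2 ^ k * gSeq μ χ b n < χ ω} ≤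
        n * (q ^ k * μ.real {ω | gSeq μ χ b n < χ ω}) := by
          gcongr
          exact hdecpow _ (by linarith [hn.1]) k
      _ = q ^ k * (n * μ.real {ω | gSeq μ χ b n < χ ω}) := by ring
      _ ≤ _ := by gcongr; exact hn.2
  have hfb : ∀ᶠ n in atTop, ∀ k, 0 ≤ f n k ∧ f n k ≤ A ^ (k + 2) * P n k := by
    filter_upwards [hgood, eventually_ge_atTop 1] with n hn hn1 k
    obtain ⟨hm0, hmk⟩ := hA _ hn.1
    have hn0 : (0 : ℝ) < n := by exact_mod_cast hn1
    have hmk0 : 0 ≤ mT μ χ (2 ^ (k + 2) * gSeq μ χ b n) := by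
      unfold mT
      refine integral_nonneg fun ω => ?_
      dsimp only
      split_ifs
      · exact h0 ω
      · exact le_rfl
    have := hP0 n k
    constructor
    · simp only [hf]; positivity
    · simp only [hf]
      rw [div_le_iff₀ (by positivity)]
      calc (n * mT μ χ (2 ^ (k + 2) * gSeq μ χ b n)) * P n k ≤
          (n * (A ^ (k + 2) * mT μ χ (gSeq μ χ b n))) * P n k := by
            gcongr
            exact hmk _
        _ = _ := by ring
  have hmain : Tendsto (fun n => ∑' k, f n k) atTop (𝓝 (∑' _ : ℕ, (0 : ℝ))) := by
    refine tendsto_tsum_of_dominated_convergence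
      (bound := fun k => (r * A ^ 2 * (Real.exp (4 * r) * q) ^ M) * (A * q ^ M) ^ k) ?_ ?_ ?_
    · exact (summable_geometric_of_lt_one (by positivity) hAq).mul_left _
    · intro k
      have hPk : Tendsto (fun n => P n k) atTop (𝓝 0) := by
        rw [Metric.tendsto_nhds]
        intro ε hε
        obtain ⟨B₀, hB₀⟩ := conc μ T hT χ hχ r hr1 ψ hψ0 hψ1 hmix q hq0 hq1 (ε / 2) (by positivity)
        have hbR : Tendsto (fun n => (b n : ℝ)) atTop atTop :=
          tendsto_natCast_atTop_atTop.comp hb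
        filter_upwards [hgood, hbR.eventually_ge_atTop B₀] with n hn hbn
        have h1 := hB₀ n (b n) (2 ^ (k + 1) * gSeq μ χ b n) hbn (by
          refine (hnp n hn (k + 1)).trans ?_
          have : q ^ (k + 1) ≤ q := by
            rw [pow_succ]
            exact mul_le_of_le_one_left hq0.le (pow_le_one₀ hq0.le hq1.le)
          gcongr)
        rw [Real.dist_eq, sub_zero, abs_of_nonneg (hP0 n k)]
        change P n k ≤ ε / 2 at h1
        linarith
      have h2 : Tendsto (fun n => A ^ (k + 2) * P n k) atTop (𝓝 0) := by
        simpa using hPk.const_mul (A ^ (k + 2))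
      exact squeeze_zero' (hfb.mono fun n hn => (hn k).1) (hfb.mono fun n hn => (hn k).2) h2
    · filter_upwards [hgood, hfb, hb.eventually_ge_atTop (4 * r),
        hb.eventually_ge_atTop (2 * r * M)] with n hn hfn hb4 hbM k
      rw [Real.norm_eq_abs, abs_of_nonneg (hfn k).1]
      have h1 : P n k ≤ r * (Real.exp (4 * r) * q ^ (k + 1)) ^ M :=
        large_dev μ T hT χ hχ r hr1 ψ hψ1 hmix _ (q ^ (k + 1)) (by positivity) n (b n) M hb4 hbM
          (hnp n hn (k + 1))
      calc f n k ≤ A ^ (k + 2) * P n k := (hfn k).2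
        _ ≤ A ^ (k + 2) * (r * (Real.exp (4 * r) * q ^ (k + 1)) ^ M) := by gcongr
        _ = _ := by
          rw [mul_pow, mul_pow, mul_pow, ← pow_mul, ← pow_mul]
          ring
  rw [tsum_zero] at hmain
  refine hmain.congr fun n => ?_
  rw [← tsum_div_const]
  refine tsum_congr fun k => ?_
  simp only [hf, hP]
  rw [integral_truncSumN μ T hT χ hχ h0, integral_truncSumN μ T hT χ hχ h0]
  simp only [card_filter_Icc_eq]
  rfl
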